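/- arXiv:2411.13371 — 3 statements merged into one kernel-verified Lean document; each statement's English description precedes it below -/
import Mathlib

section
/- Let α and β be nonempty dotted compositions such that the last entry of α and the first entry of β are both undotted, let α ⊢ (n_α, m_α) and β ⊢ (n_β, m_β), and set d = n_α + m_α. Then for any dotted composition σ with σ ⊢ (n_α+n_β, m_α+m_β): σ ⪯ α⊙β if and only if D(α) ∪ D_d(β) ⊆ D(σ), E(α) ∪ E_d(β) = E(σ), and F(α) ∪ F_d(β) = F(σ). -/
/-! ## Dotted compositions -/

/-- An entry of a dotted composition: either an undotted positive integer
or a dotted nonnegative integer. -/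
inductive DEntry : Type
  | undot : ℕ+ → DEntry
  | dot : ℕ → DEntry
  deriving DecidableEq

/-- A dotted composition is a finite sequence of dotted-composition entries. -/
abbrev DComp : Type := List DEntry

namespace DEntry

/-- Is the entry dotted? -/
def isDot : DEntry → Bool
  | undot _ => false
  | dot _ => true

/-- The numerical value of an entry. -/
def val : DEntry → ℕ
  | undot a => a
  | dot a => a

/-- The sum of two entries, defined when not both are dotted; the sum is dotted
iff one of the two entries is dotted. -/
def add? : DEntry → DEntry → Option DEntry
  | undot a, undot b => some (undot (a + b))
  | undot a, dot b => some (dot (a + b))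
  | dot a, undot b => some (dot (a + b))
  | dot _, dot _ => none

end DEntry

namespace DComp

/-- The total degree `|α|`. -/
def deg (α : DComp) : ℕ := (α.map DEntry.val).sum

/-- The fermionic degree `m_α`: the number of dotted entries. -/
def fdeg (α : DComp) : ℕ := (α.filter (fun e => e.isDot)).length

/-- Cover relation for the order `⪯`: `α` covers `β` when `α` is obtained from `β`
by replacing two adjacent undotted parts of `β` by their (undotted) sum. -/
def StrongCover (β α : DComp) : Prop :=
  ∃ (l r : DComp) (a b : ℕ+),
    β = l ++ DEntry.undot a :: DEntry.undot b :: r ∧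
    α = l ++ DEntry.undot (a + b) :: r

/-- `StrongLe β α` means `β ⪯ α` (β strongly refines α): the reflexive-transitive
closure of the cover relation `StrongCover`. -/
def StrongLe : DComp → DComp → Prop := Relation.ReflTransGen StrongCover

/-- Cover relation for the order `⊴`: `α` covers `β` when `α` is obtained from `β`
by replacing two adjacent parts of `β`, at most one of which is dotted, by their sum
(dotted iff one of the two parts was dotted). -/
def WeakCover (β α : DComp) : Prop :=
  ∃ (l r : DComp) (x y z : DEntry),
    β = l ++ x :: y :: r ∧ DEntry.add? x y = some z ∧ α = l ++ z :: r

/-- `WeakLe β α` means `β ⊴ α` (β weakly refines α). -/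
def WeakLe : DComp → DComp → Prop := Relation.ReflTransGen WeakCover

/-- The near concatenation `α ⊙ β`, defined when `α` and `β` are nonempty and
not both the last entry of `α` and the first entry of `β` are dotted. -/
def nearConcat (α β : DComp) : Option DComp :=
  match β with
  | [] => none
  | y :: ys =>
    match α.getLast? with
    | none => none
    | some x => (DEntry.add? x y).map (fun z => α.dropLast ++ z :: ys)

end DComp

/-! ## Quasisymmetric functions in superspace as a free `ℚ`-module -/

/-- `sQSym`: the free `ℚ`-module with basis indexed by dotted compositions. -/
abbrev sQSym : Type := DComp →₀ ℚ

/-- The monomial quasisymmetric function in superspace `M_α`, as a basis element. -/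
noncomputable def Mono (α : DComp) : sQSym := Finsupp.single α 1

/-- The fundamental quasisymmetric function in superspace `L_α = ∑_{β ⪯ α} M_β`. -/
noncomputable def Fund (α : DComp) : sQSym := ∑ᶠ β ∈ {β | DComp.StrongLe β α}, Mono β

/-- The bilinear product `•` with `M_α • M_β = M_{α·β}` (concatenation). -/
noncomputable def cdot (F G : sQSym) : sQSym :=
  F.sum fun α a => G.sum fun β b => (a * b) • Mono (α ++ β)

/-- The bilinear product `⊙` with `M_α ⊙ M_β = M_{α⊙β}` when the near concatenation
is defined, and `M_α ⊙ M_β = 0` otherwise. -/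
noncomputable def odot (F G : sQSym) : sQSym :=
  F.sum fun α a => G.sum fun β b =>
    match DComp.nearConcat α β with
    | some γ => (a * b) • Mono γ
    | none => 0

/-- The antipode `S`, the `ℚ`-linear map determined by
`S(M_α) = (-1)^{ℓ(α) + binom(m_α, 2)} ∑_{γ ⊵ Rev(α)} M_γ`. -/
noncomputable def antipode (F : sQSym) : sQSym :=
  F.sum fun α c =>
    (c * (-1 : ℚ) ^ (α.length + Nat.choose (DComp.fdeg α) 2)) •
      ∑ᶠ γ ∈ {γ | DComp.WeakLe α.reverse γ}, Mono γ

namespace DComp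

/-- `α_i + η_i` for an entry: the value plus 1 if dotted. -/
def entryW (e : DEntry) : ℕ := e.val + (if e.isDot then 1 else 0)

/-- The partial sum `p_i = (α_1+η_1) + ⋯ + (α_i+η_i)` (sum of the first `i` entries). -/
def psum (α : DComp) (i : ℕ) : ℕ := ((α.take i).map entryW).sum

/-- `D(α) = {p_1, …, p_{l−1}}`. -/
def Dset (α : DComp) : Set ℕ := {d | ∃ i, 1 ≤ i ∧ i < α.length ∧ d = psum α i}

/-- `E(α) = { j : p_{i−1} < j < p_i  for some i with α_i dotted }` (0-based `k = i−1`). -/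
def Eset (α : DComp) : Set ℕ :=
  {j | ∃ k, k < α.length ∧ (α.getD k (DEntry.undot 1)).isDot = true ∧
        psum α k < j ∧ j < psum α (k + 1)}

/-- `F(α) = { p_i : α_i dotted }` (0-based `k = i−1`). -/
def Fset (α : DComp) : Set ℕ :=
  {d | ∃ k, k < α.length ∧ (α.getD k (DEntry.undot 1)).isDot = true ∧ d = psum α (k + 1)}

end DComp

namespace DComp

def Wt (α : DComp) : ℕ := (α.map entryW).sum

def Qset (α : DComp) : Set ℕ := {d | ∃ i, i < α.length ∧ d = psum α i}

lemma Wt_nil : Wt [] = 0 := rfl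
lemma Wt_cons (x : DEntry) (α : DComp) : Wt (x :: α) = entryW x + Wt α := by simp [Wt]
lemma Wt_append (l r : DComp) : Wt (l ++ r) = Wt l + Wt r := by simp [Wt]

lemma entryW_pos (x : DEntry) : 0 < entryW x := by
  cases x with
  | undot a => simp [entryW, DEntry.val]
  | dot a => simp [entryW, DEntry.isDot]

lemma entryW_undot (a : ℕ+) : entryW (DEntry.undot a) = a := by
  simp [entryW, DEntry.val, DEntry.isDot]

lemma Wt_eq (α : DComp) : Wt α = deg α + fdeg α := by
  induction α with
  | nil => rfl
  | cons x α ih =>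
    rw [Wt_cons, ih]
    cases x <;> simp [deg, fdeg, entryW, DEntry.val, DEntry.isDot] <;> omega

lemma psum_zero (α : DComp) : psum α 0 = 0 := by simp [psum]
lemma psum_succ (x : DEntry) (α : DComp) (i : ℕ) :
    psum (x :: α) (i + 1) = entryW x + psum α i := by simp [psum]

lemma mem_Q_nil (d : ℕ) : ¬ d ∈ Qset [] := by simp [Qset]
lemma mem_E_nil (d : ℕ) : ¬ d ∈ Eset [] := by simp [Eset]
lemma mem_F_nil (d : ℕ) : ¬ d ∈ Fset [] := by simp [Fset]

lemma mem_Q_cons (x : DEntry) (α : DComp) (d : ℕ) :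
    d ∈ Qset (x :: α) ↔ d = 0 ∨ (entryW x ≤ d ∧ d - entryW x ∈ Qset α) := by
  constructor
  · rintro ⟨i, hi, rfl⟩
    cases i with
    | zero => left; exact psum_zero _
    | succ i =>
      right
      rw [psum_succ]
      refine ⟨by omega, i, by simpa using hi, by omega⟩
  · rintro (rfl | ⟨h, i, hi, e⟩)
    · exact ⟨0, by simp, (psum_zero _).symm⟩
    · exact ⟨i + 1, by simpa using hi, by rw [psum_succ]; omega⟩

lemma mem_E_cons (x : DEntry) (α : DComp) (d : ℕ) :
    d ∈ Eset (x :: α) ↔ (x.isDot = true ∧ 0 < d ∧ d < entryW x) ∨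
      (entryW x < d ∧ d - entryW x ∈ Eset α) := by
  constructor
  · rintro ⟨i, hi, h1, h2, h3⟩
    cases i with
    | zero =>
      left
      rw [psum_zero] at h2
      rw [psum_succ, psum_zero] at h3
      exact ⟨by simpa using h1, by omega, by omega⟩
    | succ i =>
      right
      rw [psum_succ] at h2 h3
      refine ⟨by omega, i, by simpa using hi, by simpa using h1, by omega, by omega⟩
  · rintro (⟨h1, h2, h3⟩ | ⟨h, i, hi, h1, h2, h3⟩)
    · exact ⟨0, by simp, by simpa using h1, by rw [psum_zero]; omega,
        by rw [psum_succ, psum_zero]; omega⟩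
    · exact ⟨i + 1, by simpa using hi, by simpa using h1, by rw [psum_succ]; omega,
        by rw [psum_succ]; omega⟩

lemma mem_F_cons (x : DEntry) (α : DComp) (d : ℕ) :
    d ∈ Fset (x :: α) ↔ (x.isDot = true ∧ d = entryW x) ∨
      (entryW x < d ∧ d - entryW x ∈ Fset α) := by
  constructor
  · rintro ⟨i, hi, h1, rfl⟩
    cases i with
    | zero =>
      left
      rw [psum_succ, psum_zero]
      exact ⟨by simpa using h1, by omega⟩
    | succ i =>
      right
      rw [psum_succ]
      have hi' : i < α.length := by simpa using hi
      have : 0 < psum α (i + 1) := by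
        cases α with
        | nil => simp at hi'
        | cons y α => rw [psum_succ]; have := entryW_pos y; omega
      refine ⟨by omega, i, hi', by simpa using h1, by omega⟩
  · rintro (⟨h1, h2⟩ | ⟨h, i, hi, h1, h2⟩)
    · exact ⟨0, by simp, by simpa using h1, by rw [psum_succ, psum_zero]; omega⟩
    · exact ⟨i + 1, by simpa using hi, by simpa using h1, by rw [psum_succ]; omega⟩

lemma mem_D (α : DComp) (d : ℕ) : d ∈ Dset α ↔ d ∈ Qset α ∧ 0 < d := by
  constructor
  · rintro ⟨i, h1, h2, rfl⟩
    refine ⟨⟨i, h2, rfl⟩, ?_⟩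
    cases α with
    | nil => simp at h2
    | cons y α =>
      obtain ⟨i, rfl⟩ : ∃ j, i = j + 1 := ⟨i - 1, by omega⟩
      rw [psum_succ]; have := entryW_pos y; omega
  · rintro ⟨⟨i, hi, rfl⟩, h⟩
    refine ⟨i, ?_, hi, rfl⟩
    rcases Nat.eq_zero_or_pos i with rfl | h'
    · rw [psum_zero] at h; omega
    · exact h'

lemma pos_E (α : DComp) : 0 ∉ Eset α := by
  rintro ⟨i, _, _, h, _⟩; omega

lemma pos_F (α : DComp) : 0 ∉ Fset α := by
  cases α with
  | nil => exact mem_F_nil 0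
  | cons x α => rw [mem_F_cons]; have := entryW_pos x; omega

lemma mem_Q_append (l r : DComp) (d : ℕ) :
    d ∈ Qset (l ++ r) ↔ d ∈ Qset l ∨ (Wt l ≤ d ∧ d - Wt l ∈ Qset r) := by
  induction l generalizing d with
  | nil => simp [Wt_nil, mem_Q_nil]
  | cons x l ih =>
    rw [List.cons_append, mem_Q_cons, mem_Q_cons, ih, Wt_cons, Nat.sub_sub]
    constructor
    · rintro (h | ⟨h, h' | ⟨h', h''⟩⟩)
      · tauto
      · tauto
      · exact Or.inr ⟨by omega, h''⟩
    · rintro ((h | h) | ⟨h, h'⟩)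
      · tauto
      · tauto
      · exact Or.inr ⟨by omega, Or.inr ⟨by omega, h'⟩⟩

lemma mem_E_append (l r : DComp) (d : ℕ) :
    d ∈ Eset (l ++ r) ↔ d ∈ Eset l ∨ (Wt l < d ∧ d - Wt l ∈ Eset r) := by
  induction l generalizing d with
  | nil =>
    have := pos_E r
    rcases Nat.eq_zero_or_pos d with rfl | h
    · simp [Wt_nil, mem_E_nil, this]
    · simp [Wt_nil, mem_E_nil, h]
  | cons x l ih =>
    rw [List.cons_append, mem_E_cons, mem_E_cons, ih, Wt_cons, Nat.sub_sub]
    constructor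
    · rintro (h | ⟨h, h' | ⟨h', h''⟩⟩)
      · tauto
      · tauto
      · exact Or.inr ⟨by omega, h''⟩
    · rintro ((h | h) | ⟨h, h'⟩)
      · tauto
      · tauto
      · exact Or.inr ⟨by omega, Or.inr ⟨by omega, h'⟩⟩

lemma mem_F_append (l r : DComp) (d : ℕ) :
    d ∈ Fset (l ++ r) ↔ d ∈ Fset l ∨ (Wt l < d ∧ d - Wt l ∈ Fset r) := by
  induction l generalizing d with
  | nil =>
    have := pos_F r
    rcases Nat.eq_zero_or_pos d with rfl | h
    · simp [Wt_nil, mem_F_nil, this]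
    · simp [Wt_nil, mem_F_nil, h]
  | cons x l ih =>
    rw [List.cons_append, mem_F_cons, mem_F_cons, ih, Wt_cons, Nat.sub_sub]
    constructor
    · rintro (h | ⟨h, h' | ⟨h', h''⟩⟩)
      · tauto
      · tauto
      · exact Or.inr ⟨by omega, h''⟩
    · rintro ((h | h) | ⟨h, h'⟩)
      · tauto
      · tauto
      · exact Or.inr ⟨by omega, Or.inr ⟨by omega, h'⟩⟩

lemma isDot_undot (a : ℕ+) : (DEntry.undot a).isDot = false := rfl

lemma E_undot (a : ℕ+) (r : DComp) (d : ℕ) : d ∈ Eset (DEntry.undot a :: r) ↔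
    (a : ℕ) < d ∧ d - a ∈ Eset r := by
  rw [mem_E_cons, isDot_undot, entryW_undot]; simp

lemma F_undot (a : ℕ+) (r : DComp) (d : ℕ) : d ∈ Fset (DEntry.undot a :: r) ↔
    (a : ℕ) < d ∧ d - a ∈ Fset r := by
  rw [mem_F_cons, isDot_undot, entryW_undot]; simp

lemma Q_undot (a : ℕ+) (r : DComp) (d : ℕ) : d ∈ Qset (DEntry.undot a :: r) ↔
    d = 0 ∨ ((a : ℕ) ≤ d ∧ d - a ∈ Qset r) := by
  rw [mem_Q_cons, entryW_undot]

lemma E_split (a b : ℕ+) (r : DComp) :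
    Eset (DEntry.undot a :: DEntry.undot b :: r) = Eset (DEntry.undot (a + b) :: r) := by
  ext d
  rw [E_undot, E_undot, E_undot, PNat.add_coe, Nat.sub_sub, ← and_assoc]
  exact and_congr_left fun _ => by omega

lemma F_split (a b : ℕ+) (r : DComp) :
    Fset (DEntry.undot a :: DEntry.undot b :: r) = Fset (DEntry.undot (a + b) :: r) := by
  ext d
  rw [F_undot, F_undot, F_undot, PNat.add_coe, Nat.sub_sub, ← and_assoc]
  exact and_congr_left fun _ => by omega

lemma Q_split (a b : ℕ+) (r : DComp) :
    Qset (DEntry.undot (a + b) :: r) ⊆ Qset (DEntry.undot a :: DEntry.undot b :: r) := by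
  intro d
  rw [Q_undot, Q_undot, Q_undot, PNat.add_coe, Nat.sub_sub]
  rintro (h | ⟨h, h'⟩)
  · exact Or.inl h
  · exact Or.inr ⟨by omega, Or.inr ⟨by omega, h'⟩⟩

lemma cover_sets {σ γ : DComp} (h : StrongCover σ γ) :
    Qset γ ⊆ Qset σ ∧ Eset γ = Eset σ ∧ Fset γ = Fset σ := by
  obtain ⟨l, r, a, b, rfl, rfl⟩ := h
  refine ⟨?_, ?_, ?_⟩
  · intro d
    rw [mem_Q_append, mem_Q_append]
    exact Or.imp id (And.imp id (fun h => Q_split a b r h))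
  · ext d; rw [mem_E_append, mem_E_append, E_split]
  · ext d; rw [mem_F_append, mem_F_append, F_split]

lemma le_sets {σ γ : DComp} (h : StrongLe σ γ) :
    Qset γ ⊆ Qset σ ∧ Eset γ = Eset σ ∧ Fset γ = Fset σ := by
  induction h with
  | refl => exact ⟨subset_rfl, rfl, rfl⟩
  | tail _ h ih =>
    obtain ⟨h1, h2, h3⟩ := cover_sets h
    exact ⟨h1.trans ih.1, h2.trans ih.2.1, h3.trans ih.2.2⟩

lemma le_cons (x : DEntry) {σ γ : DComp} (h : StrongLe σ γ) : StrongLe (x :: σ) (x :: γ) := by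
  induction h with
  | refl => exact Relation.ReflTransGen.refl
  | tail _ h ih =>
    obtain ⟨l, r, a, b, rfl, rfl⟩ := h
    exact ih.tail ⟨x :: l, r, a, b, rfl, rfl⟩

lemma zero_mem_Q (x : DEntry) (α : DComp) : 0 ∈ Qset (x :: α) := by
  rw [mem_Q_cons]; exact Or.inl rfl

lemma entry_ext {x y : DEntry} (h : entryW x = entryW y) (h' : x.isDot = true ↔ y.isDot = true) :
    x = y := by
  cases x <;> cases y <;> simp_all [entryW, DEntry.isDot, DEntry.val]

lemma cancel {x : DEntry} {σ γ : DComp} (hQ : Qset (x :: γ) ⊆ Qset (x :: σ))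
    (hE : Eset (x :: γ) = Eset (x :: σ)) (hF : Fset (x :: γ) = Fset (x :: σ)) :
    Qset γ ⊆ Qset σ ∧ Eset γ = Eset σ ∧ Fset γ = Fset σ := by
  have hx := entryW_pos x
  refine ⟨?_, ?_, ?_⟩
  · intro d hd
    have := @hQ (entryW x + d)
    rw [mem_Q_cons, mem_Q_cons, Nat.add_sub_cancel_left] at this
    rcases this (Or.inr ⟨by omega, hd⟩) with h | h
    · omega
    · exact h.2
  · ext d
    rcases Nat.eq_zero_or_pos d with rfl | h0
    · simp [pos_E]
    have := Set.ext_iff.1 hE (entryW x + d)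
    rw [mem_E_cons, mem_E_cons, Nat.add_sub_cancel_left] at this
    have h1 : ¬ (entryW x + d < entryW x) := by omega
    have h2 : entryW x < entryW x + d := by omega
    simpa only [h1, h2, and_false, false_or, true_and] using this
  · ext d
    rcases Nat.eq_zero_or_pos d with rfl | h0
    · simp [pos_F]
    have := Set.ext_iff.1 hF (entryW x + d)
    rw [mem_F_cons, mem_F_cons, Nat.add_sub_cancel_left] at this
    have h1 : ¬ (entryW x + d = entryW x) := by omega
    have h2 : entryW x < entryW x + d := by omega
    simpa only [h1, h2, and_false, false_or, true_and] using this

lemma sets_le (σ : DComp) : ∀ γ : DComp, Wt γ = Wt σ → Qset γ ⊆ Qset σ →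
    Eset γ = Eset σ → Fset γ = Fset σ → StrongLe σ γ := by
  induction σ with
  | nil =>
    intro γ _ hQ _ _
    cases γ with
    | nil => exact Relation.ReflTransGen.refl
    | cons y γ => exact absurd (hQ (zero_mem_Q y γ)) (mem_Q_nil 0)
  | cons x σ ih =>
    intro γ hW hQ hE hF
    have hx := entryW_pos x
    cases γ with
    | nil => rw [Wt_nil, Wt_cons] at hW; omega
    | cons y γ =>
      have hy := entryW_pos y
      have hle : entryW x ≤ entryW y := by
        cases γ with
        | nil => rw [Wt_cons, Wt_cons, Wt_nil] at hW; omega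
        | cons z γ =>
          have := @hQ (entryW y)
          rw [mem_Q_cons, mem_Q_cons x, Nat.sub_self] at this
          rcases this (Or.inr ⟨le_rfl, zero_mem_Q _ _⟩) with h | h
          · omega
          · exact h.1
      have hFx := Set.ext_iff.1 hF (entryW x)
      have hEx := Set.ext_iff.1 hE (entryW x)
      rw [mem_F_cons, mem_F_cons] at hFx
      rw [mem_E_cons, mem_E_cons] at hEx
      rcases hle.eq_or_lt with heq | hlt
      · have hxy : x = y := by
          apply entry_ext heq
          simp only [heq, lt_irrefl, false_and, or_false, and_true] at hFx
          exact hFx.symm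
        subst hxy
        obtain ⟨h1, h2, h3⟩ := cancel hQ hE hF
        rw [Wt_cons, Wt_cons] at hW
        exact le_cons _ (ih γ (by omega) h1 h2 h3)
      · have hyd : ¬ y.isDot = true := by
          intro h
          have := hEx.1 (Or.inl ⟨h, hx, hlt⟩)
          omega
        have hxd : ¬ x.isDot = true := by
          intro h
          have := hFx.2 (Or.inl ⟨h, rfl⟩)
          omega
        cases x with
        | dot a => exact absurd rfl hxd
        | undot a =>
        cases y with
        | dot a => exact absurd rfl hyd
        | undot c =>
        rw [entryW_undot, entryW_undot] at hlt
        obtain ⟨b, rfl⟩ : ∃ b : ℕ+, c = a + b := by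
          refine ⟨c - a, ?_⟩
          exact (PNat.add_sub_of_lt (by exact_mod_cast hlt)).symm
        have hσ : 0 ∈ Qset σ := by
          cases σ with
          | nil =>
            rw [Wt_cons, Wt_cons, Wt_nil, entryW_undot, entryW_undot] at hW
            omega
          | cons z σ => exact zero_mem_Q _ _
        have hQ' : Qset (DEntry.undot a :: DEntry.undot b :: γ) ⊆ Qset (DEntry.undot a :: σ) := by
          intro d hd
          rw [Q_undot, Q_undot] at hd
          rcases hd with rfl | ⟨h, h' | ⟨h', h''⟩⟩
          · exact zero_mem_Q _ _
          · rw [Q_undot]; right; rw [h']; exact ⟨h, hσ⟩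
          · apply hQ
            rw [Q_undot, PNat.add_coe, ← Nat.sub_sub]
            exact Or.inr ⟨by omega, h''⟩
        obtain ⟨h1, h2, h3⟩ := cancel hQ' ((E_split a b γ).trans hE) ((F_split a b γ).trans hF)
        have hW' : Wt (DEntry.undot b :: γ) = Wt σ := by
          rw [Wt_cons, Wt_cons, entryW_undot, entryW_undot, PNat.add_coe] at hW
          rw [Wt_cons, entryW_undot]
          omega
        exact (le_cons _ (ih _ hW' h1 h2 h3)).tail ⟨[], γ, a, b, rfl, rfl⟩

lemma image_add_mem (S : Set ℕ) (k d : ℕ) : d ∈ (· + k) '' S ↔ k ≤ d ∧ d - k ∈ S := by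
  constructor
  · rintro ⟨e, he, rfl⟩
    exact ⟨by simp, by simpa using he⟩
  · rintro ⟨h, h'⟩
    exact ⟨_, h', by simp; omega⟩

end DComp

open DComp

/-- Let `α`, `β` be nonempty dotted compositions whose last
(resp. first) entry is undotted, `α ⊢ (n_α, m_α)`, `β ⊢ (n_β, m_β)`, and
`d = n_α + m_α`.  For any dotted composition `σ ⊢ (n_α+n_β, m_α+m_β)`:
`σ ⪯ α⊙β ↔ D(α) ∪ D_d(β) ⊆ D(σ), E(α) ∪ E_d(β) = E(σ), F(α) ∪ F_d(β) = F(σ)`. -/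
theorem strongLe_nearConcat_iff_sets (α β : DComp)
    (hα : ∃ a : ℕ+, α.getLast? = some (DEntry.undot a))
    (hβ : ∃ b : ℕ+, β.head? = some (DEntry.undot b))
    (nα mα nβ mβ : ℕ)
    (hnα : DComp.deg α = nα) (hmα : DComp.fdeg α = mα)
    (hnβ : DComp.deg β = nβ) (hmβ : DComp.fdeg β = mβ)
    (γ : DComp) (hγ : DComp.nearConcat α β = some γ)
    (σ : DComp) (hnσ : DComp.deg σ = nα + nβ) (hmσ : DComp.fdeg σ = mα + mβ) :
    DComp.StrongLe σ γ ↔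
      (DComp.Dset α ∪ ((· + (nα + mα)) '' DComp.Dset β) ⊆ DComp.Dset σ ∧
        DComp.Eset α ∪ ((· + (nα + mα)) '' DComp.Eset β) = DComp.Eset σ ∧
        DComp.Fset α ∪ ((· + (nα + mα)) '' DComp.Fset β) = DComp.Fset σ) := by
  obtain ⟨a, ha⟩ := hα
  obtain ⟨b, hb⟩ := hβ
  obtain ⟨α0, rfl⟩ := List.getLast?_eq_some_iff.1 ha
  obtain ⟨β0, rfl⟩ := List.head?_eq_some_iff.1 hb
  simp only [nearConcat, ha, DEntry.add?, Option.map_some, List.dropLast_concat,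
    Option.some.injEq] at hγ
  have hd : nα + mα = Wt α0 + a := by
    rw [← hnα, ← hmα, ← Wt_eq, Wt_append, Wt_cons, entryW_undot, Wt_nil, Nat.add_zero]
  have hdβ : nβ + mβ = b + Wt β0 := by
    rw [← hnβ, ← hmβ, ← Wt_eq, Wt_cons, entryW_undot]
  have hWσ : Wt σ = Wt α0 + a + (b + Wt β0) := by
    rw [Wt_eq]; omega
  have hWγ : Wt γ = Wt σ := by
    rw [hWσ, ← hγ, Wt_append, Wt_cons, entryW_undot, PNat.add_coe]; omega
  have ha0 := a.pos
  have hb0 := b.pos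
  have hD : Dset (α0 ++ [DEntry.undot a]) ∪
      ((· + (nα + mα)) '' Dset (DEntry.undot b :: β0)) = Dset γ := by
    ext d
    rw [Set.mem_union, image_add_mem, mem_D, mem_D, mem_D, ← hγ, mem_Q_append, mem_Q_append,
      Q_undot, Q_undot, Q_undot, hd, PNat.add_coe, Nat.sub_sub, Nat.sub_sub, Nat.sub_sub,
      ← Nat.add_assoc]
    have := mem_Q_nil (d - (Wt α0 + a))
    generalize (d - (Wt α0 + a + b) ∈ Qset β0) = P at *
    generalize (d - (Wt α0 + a) ∈ Qset []) = P' at *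
    generalize (d ∈ Qset α0) = P'' at *
    clear hnα hmα hnβ hmβ hnσ hmσ hWσ hWγ hdβ hd
    by_cases h1 : P <;> by_cases h2 : P'' <;>
      simp only [h1, h2, this, and_true, and_false, true_and, true_or, false_or, or_false] <;>
      omega
  have hE : Eset (α0 ++ [DEntry.undot a]) ∪
      ((· + (nα + mα)) '' Eset (DEntry.undot b :: β0)) = Eset γ := by
    ext d
    rw [Set.mem_union, image_add_mem, ← hγ, mem_E_append, mem_E_append,
      E_undot, E_undot, E_undot, hd, PNat.add_coe, Nat.sub_sub, Nat.sub_sub, Nat.sub_sub,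
      ← Nat.add_assoc]
    have := mem_E_nil (d - (Wt α0 + a))
    generalize (d - (Wt α0 + a + b) ∈ Eset β0) = P at *
    generalize (d - (Wt α0 + a) ∈ Eset []) = P' at *
    generalize (d ∈ Eset α0) = P'' at *
    clear hnα hmα hnβ hmβ hnσ hmσ hWσ hWγ hdβ hd
    by_cases h1 : P <;> by_cases h2 : P'' <;>
      simp only [h1, h2, this, and_true, and_false, true_and, true_or, false_or, or_false] <;>
      omega
  have hF : Fset (α0 ++ [DEntry.undot a]) ∪
      ((· + (nα + mα)) '' Fset (DEntry.undot b :: β0)) = Fset γ := by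
    ext d
    rw [Set.mem_union, image_add_mem, ← hγ, mem_F_append, mem_F_append,
      F_undot, F_undot, F_undot, hd, PNat.add_coe, Nat.sub_sub, Nat.sub_sub, Nat.sub_sub,
      ← Nat.add_assoc]
    have := mem_F_nil (d - (Wt α0 + a))
    generalize (d - (Wt α0 + a + b) ∈ Fset β0) = P at *
    generalize (d - (Wt α0 + a) ∈ Fset []) = P' at *
    generalize (d ∈ Fset α0) = P'' at *
    clear hnα hmα hnβ hmβ hnσ hmσ hWσ hWγ hdβ hd
    by_cases h1 : P <;> by_cases h2 : P'' <;>
      simp only [h1, h2, this, and_true, and_false, true_and, true_or, false_or, or_false] <;>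
      omega
  rw [hD, hE, hF]
  constructor
  · intro h
    obtain ⟨h1, h2, h3⟩ := le_sets h
    refine ⟨?_, h2, h3⟩
    intro d
    rw [mem_D, mem_D]
    exact And.imp (fun h => h1 h) id
  · rintro ⟨h1, h2, h3⟩
    refine sets_le σ γ hWγ ?_ h2 h3
    intro d hdγ
    rcases Nat.eq_zero_or_pos d with rfl | h0
    · cases σ with
      | nil => rw [Wt_nil] at hWσ; omega
      | cons z σ => exact zero_mem_Q _ _
    · exact ((mem_D _ _).1 (h1 ((mem_D _ _).2 ⟨hdγ, h0⟩))).1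
end

section
/- Let α and β be nonempty dotted compositions such that the last entry of α and the first entry of β are both undotted. Then, in sQSym, Σ_{σ ⪯ α⊙β} M_σ = Σ_{γ ⪯ α} Σ_{η ⪯ β} ( M_{γ·η} + M_{γ⊙η} ). (Note that for γ ⪯ α and η ⪯ β, the last entry of γ and the first entry of η are both undotted, so γ⊙η is defined.) -/
namespace NC

open DComp DEntry

def w : DEntry → ℕ
  | undot a => a
  | dot n => n + 1

def W (α : DComp) : ℕ := (α.map w).sum

lemma w_pos (e : DEntry) : 0 < w e := by
  cases e <;> simp [w]

@[simp] lemma W_nil : W [] = 0 := rfl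
@[simp] lemma W_cons (e : DEntry) (l : DComp) : W (e :: l) = w e + W l := by simp [W]
@[simp] lemma W_append (l r : DComp) : W (l ++ r) = W l + W r := by simp [W]
@[simp] lemma w_undot (a : ℕ+) : w (undot a) = a := rfl

lemma finite_w (N : ℕ) : {e : DEntry | w e ≤ N}.Finite := by
  have h1 : (Set.Iic N).Finite := Set.finite_Iic N
  refine ((h1.image dot).union (h1.image (fun n => undot (Nat.toPNat' n)))).subset ?_
  intro e he
  cases e with
  | undot a => right; exact ⟨a, he, by simp⟩
  | dot n => left; exact ⟨n, by simp [w] at he ⊢; omega, rfl⟩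

lemma finite_W (N : ℕ) : {σ : DComp | W σ ≤ N}.Finite := by
  induction N with
  | zero =>
    refine (Set.finite_singleton []).subset ?_
    intro σ h
    cases σ with
    | nil => simp
    | cons e l => have := w_pos e; simp at h; omega
  | succ N ih =>
    refine ((Set.finite_singleton []).union (Set.Finite.image2 List.cons (finite_w (N+1)) ih)).subset ?_
    intro σ h
    cases σ with
    | nil => simp
    | cons e l =>
      right
      have := w_pos e
      simp at h
      exact ⟨e, by simp; omega, l, by simp; omega, rfl⟩

lemma cover_W {σ α : DComp} (h : StrongCover σ α) : W σ = W α := by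
  obtain ⟨l, r, a, b, rfl, rfl⟩ := h
  simp; omega

lemma le_W {σ α : DComp} (h : StrongLe σ α) : W σ = W α := by
  induction h with
  | refl => rfl
  | tail _ h2 ih => rw [ih, cover_W h2]

lemma finite_le (α : DComp) : {σ | StrongLe σ α}.Finite :=
  (finite_W (W α)).subset fun _ h => (le_W h).le

lemma sle_trans {x y z : DComp} (h : StrongLe x y) (h' : StrongLe y z) : StrongLe x z :=
  Relation.ReflTransGen.trans h h'

lemma pnat_lt {x y : ℕ+} (h : x < y) : ∃ z, y = x + z :=
  ⟨y - x, (PNat.add_sub_of_lt h).symm⟩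

lemma cover_le {l r : DComp} {a b : ℕ+} :
    StrongLe (l ++ undot a :: undot b :: r) (l ++ undot (a + b) :: r) :=
  Relation.ReflTransGen.single ⟨l, r, a, b, rfl, rfl⟩

lemma le_append {γ α : DComp} (h : StrongLe γ α) (l r : DComp) :
    StrongLe (l ++ γ ++ r) (l ++ α ++ r) := by
  induction h with
  | refl => exact Relation.ReflTransGen.refl
  | tail _ h2 ih =>
    refine sle_trans ih ?_
    obtain ⟨l', r', a, b, rfl, rfl⟩ := h2
    have := @cover_le (l ++ l') (r' ++ r) a b
    simpa using this

lemma last_le {γ A : DComp} {a : ℕ+} (h : StrongLe γ (A ++ [undot a])) :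
    ∃ g c, γ = g ++ [undot c] ∧
      ∀ d h, StrongLe (g ++ undot (c + d) :: h) (A ++ undot (a + d) :: h) := by
  induction h using Relation.ReflTransGen.head_induction_on with
  | refl => exact ⟨A, a, rfl, fun _ _ => Relation.ReflTransGen.refl⟩
  | head h1 _ ih =>
    obtain ⟨g, c, rfl, ih⟩ := ih
    obtain ⟨l, r, x, y, rfl, h⟩ := h1
    rcases List.eq_nil_or_concat r with rfl | ⟨r', e, rfl⟩
    · have := List.append_inj' h rfl
      obtain ⟨rfl, h⟩ := this
      simp at h
      subst h
      refine ⟨g ++ [undot x], y, by simp, fun d h => ?_⟩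
      refine sle_trans ?_ (ih d h)
      have := @cover_le g h x (y + d)
      rw [← add_assoc] at this
      simpa using this
    · have h' : g ++ [undot c] = (l ++ undot (x + y) :: r') ++ [e] := by simpa using h
      obtain ⟨rfl, h'⟩ := List.append_inj' h' rfl
      simp at h'
      subst h'
      refine ⟨l ++ undot x :: undot y :: r', c, by simp, fun d h => ?_⟩
      refine sle_trans ?_ (ih d h)
      have := @cover_le l (r' ++ undot (c + d) :: h) x y
      simpa using this

lemma head_le {η B : DComp} {b : ℕ+} (h : StrongLe η (undot b :: B)) :
    ∃ d h, η = undot d :: h ∧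
      ∀ g c, StrongLe (g ++ undot (c + d) :: h) (g ++ undot (c + b) :: B) := by
  induction h using Relation.ReflTransGen.head_induction_on with
  | refl => exact ⟨b, B, rfl, fun _ _ => Relation.ReflTransGen.refl⟩
  | head h1 _ ih =>
    obtain ⟨d, h, rfl, ih⟩ := ih
    obtain ⟨l, r, x, y, rfl, h1⟩ := h1
    cases l with
    | nil =>
      simp at h1
      obtain ⟨rfl, rfl⟩ := h1
      refine ⟨x, undot y :: h, by simp, fun g c => ?_⟩
      refine sle_trans ?_ (ih g c)
      have := @cover_le g h (c + x) y
      rwa [add_assoc] at this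
    | cons e l =>
      simp at h1
      obtain ⟨rfl, rfl⟩ := h1
      refine ⟨d, l ++ undot x :: undot y :: r, by simp, fun g c => ?_⟩
      refine sle_trans ?_ (ih g c)
      have := @cover_le (g ++ undot (c + d) :: l) r x y
      simpa using this

/-- comparing two ways to mark an entry in a list -/
lemma mark {l r g h : DComp} {x y : DEntry} (H : g ++ x :: h = l ++ y :: r) :
    (g = l ∧ x = y ∧ h = r) ∨ (∃ m, l = g ++ x :: m ∧ h = m ++ y :: r) ∨
      (∃ m, g = l ++ y :: m ∧ r = m ++ x :: h) := by
  rcases List.append_eq_append_iff.1 H with ⟨m, h1, h2⟩ | ⟨m, h1, h2⟩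
  · cases m with
    | nil => simp at h1 h2; grind
    | cons e m => simp at h2; grind
  · cases m with
    | nil => simp at h1 h2; grind
    | cons e m => simp at h2; grind

lemma surj {A B : DComp} {a b : ℕ+} {σ : DComp}
    (h : StrongLe σ (A ++ undot (a + b) :: B)) :
    (∃ γ η, StrongLe γ (A ++ [undot a]) ∧ StrongLe η (undot b :: B) ∧ σ = γ ++ η) ∨
    (∃ g c d h, StrongLe (g ++ [undot c]) (A ++ [undot a]) ∧
      StrongLe (undot d :: h) (undot b :: B) ∧ σ = g ++ undot (c + d) :: h) := by
  induction h using Relation.ReflTransGen.head_induction_on with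
  | refl => exact .inr ⟨A, a, b, B, Relation.ReflTransGen.refl, Relation.ReflTransGen.refl, rfl⟩
  | head h1 _ ih =>
    obtain ⟨l, r, x, y, rfl, h1⟩ := h1
    rcases ih with ⟨γ, η, hγ, hη, rfl⟩ | ⟨g, c, d, h, hγ, hη, rfl⟩
    · left
      rcases List.append_eq_append_iff.1 h1 with ⟨m, rfl, rfl⟩ | ⟨m, rfl, h2⟩
      · exact ⟨γ, m ++ undot x :: undot y :: r, hγ, cover_le.trans hη, by simp⟩
      · cases m with
        | nil =>
          simp at h2
          subst h2
          exact ⟨l, undot x :: undot y :: r, by simpa using hγ,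
            (cover_le (l := [])).trans hη, by simp⟩
        | cons e m =>
          simp at h2
          obtain ⟨rfl, rfl⟩ := h2
          exact ⟨l ++ undot x :: undot y :: m, η, cover_le.trans hγ, hη, by simp⟩
    · rcases mark h1 with ⟨rfl, h2, rfl⟩ | ⟨m, rfl, rfl⟩ | ⟨m, rfl, rfl⟩
      · simp at h2
        rcases lt_trichotomy x c with hx | rfl | hx
        · obtain ⟨c', rfl⟩ := pnat_lt hx
          have : c' + d = y := by rw [add_assoc] at h2; exact add_left_cancel h2
          subst this
          exact .inr ⟨g ++ [undot x], c', d, h, by simpa using sle_trans (cover_le (r := [])) hγ, hη,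
            by simp⟩
        · have : d = y := add_left_cancel h2
          subst this
          exact .inl ⟨_, _, hγ, hη, by simp⟩
        · obtain ⟨c', rfl⟩ := pnat_lt hx
          have : d = c' + y := by rw [add_assoc] at h2; exact add_left_cancel h2
          subst this
          exact .inr ⟨g, c, c', undot y :: h, hγ, (cover_le (l := [])).trans hη, by simp⟩
      · exact .inr ⟨g, c, d, m ++ undot x :: undot y :: r, hγ,
          (cover_le (l := undot d :: m)).trans hη, by simp⟩
      · refine .inr ⟨l ++ undot x :: undot y :: m, c, d, h, ?_, hη, by simp⟩
        have := @cover_le l (m ++ [undot c]) x y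
        exact sle_trans (by simpa using this) hγ

lemma inj1 {γ η γ' η' : DComp} (h : γ ++ η = γ' ++ η') (hW : W γ = W γ') :
    γ = γ' ∧ η = η' := by
  rcases List.append_eq_append_iff.1 h with ⟨m, rfl, rfl⟩ | ⟨m, rfl, rfl⟩ <;>
  · cases m with
    | nil => simp
    | cons e m => have := w_pos e; simp only [W_append, W_cons] at hW; omega

lemma disj {γ η g h : DComp} {c d : ℕ+} (H : γ ++ η = g ++ undot (c + d) :: h)
    (hW : W γ = W (g ++ [undot c])) : False := by
  have := c.pos
  have := d.pos
  rcases List.append_eq_append_iff.1 H with ⟨m, rfl, h2⟩ | ⟨m, rfl, h2⟩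
  · simp at hW
  · cases m with
    | nil => simp at hW
    | cons e m =>
      simp at h2
      obtain ⟨rfl, rfl⟩ := h2
      simp at hW; omega

lemma inj2 {g h g' h' : DComp} {c d c' d' : ℕ+}
    (H : g ++ undot (c + d) :: h = g' ++ undot (c' + d') :: h')
    (hW : W (g ++ [undot c]) = W (g' ++ [undot c'])) :
    g = g' ∧ c = c' ∧ d = d' ∧ h = h' := by
  have := c.pos
  have := d.pos
  have := c'.pos
  have := d'.pos
  rcases mark H with ⟨rfl, h2, rfl⟩ | ⟨m, rfl, rfl⟩ | ⟨m, rfl, rfl⟩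
  · simp at hW h2
    subst hW
    exact ⟨rfl, rfl, add_left_cancel h2, rfl⟩
  · simp at hW; omega
  · simp at hW; omega

def nc (p : DComp × DComp) : DComp := (nearConcat p.1 p.2).getD []

lemma nearConcat_eq (g h : DComp) (c d : ℕ+) :
    nearConcat (g ++ [undot c]) (undot d :: h) = some (g ++ undot (c + d) :: h) := by
  simp [nearConcat, add?]

lemma nc_eq (g h : DComp) (c d : ℕ+) :
    nc (g ++ [undot c], undot d :: h) = g ++ undot (c + d) :: h := by
  simp [nc, nearConcat_eq]

lemma odot_eq (g h : DComp) (c d : ℕ+) :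
    odot (Mono (g ++ [undot c])) (Mono (undot d :: h)) = Mono (g ++ undot (c + d) :: h) := by
  unfold odot Mono
  rw [Finsupp.sum_single_index, Finsupp.sum_single_index]
  · rw [nearConcat_eq]
    simp
  · rw [nearConcat_eq]
    simp
  · rw [Finsupp.sum_single_index] <;> · rw [nearConcat_eq]; simp

end NC

open NC DComp DEntry in
/-- If the last entry of `α` and the first entry of `β` are both
undotted, then `∑_{σ ⪯ α⊙β} M_σ = ∑_{γ ⪯ α} ∑_{η ⪯ β} (M_{γ·η} + M_{γ⊙η})`.
(For `γ ⪯ α` and `η ⪯ β` the near concatenation `γ⊙η` is defined, and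
`M_γ ⊙ M_η = M_{γ⊙η}`.) -/
theorem sum_refinements_nearConcat (α β : DComp)
    (hα : ∃ a : ℕ+, α.getLast? = some (DEntry.undot a))
    (hβ : ∃ b : ℕ+, β.head? = some (DEntry.undot b))
    (γ₀ : DComp) (hγ : DComp.nearConcat α β = some γ₀) :
    (∑ᶠ σ ∈ {σ | DComp.StrongLe σ γ₀}, Mono σ) =
      ∑ᶠ p ∈ {p : DComp × DComp | DComp.StrongLe p.1 α ∧ DComp.StrongLe p.2 β},
        (Mono (p.1 ++ p.2) + odot (Mono p.1) (Mono p.2)) := by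
  obtain ⟨a, ha⟩ := hα
  obtain ⟨b, hb⟩ := hβ
  obtain ⟨A, rfl⟩ := List.getLast?_eq_some_iff.1 ha
  obtain ⟨B, rfl⟩ := List.head?_eq_some_iff.1 hb
  rw [nearConcat_eq] at hγ
  simp only [Option.some.injEq] at hγ
  subst hγ
  set T := {p : DComp × DComp | DComp.StrongLe p.1 (A ++ [undot a]) ∧
    DComp.StrongLe p.2 (undot b :: B)} with hT
  have hfin : T.Finite := (finite_le _).prod (finite_le _)
  have key : ∀ p ∈ T, ∃ g c d h, p = (g ++ [undot c], undot d :: h) ∧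
      StrongLe (g ++ undot (c + d) :: h) (A ++ undot (a + b) :: B) := by
    rintro ⟨γ, η⟩ ⟨h1, h2⟩
    obtain ⟨g, c, rfl, h3⟩ := last_le h1
    obtain ⟨d, h, rfl, h4⟩ := head_le h2
    exact ⟨g, c, d, h, rfl, (h3 d h).trans (h4 A a)⟩
  have hW : ∀ p ∈ T, ∀ q ∈ T, W p.1 = W q.1 := fun p hp q hq =>
    (le_W hp.1).trans (le_W hq.1).symm
  have e1 : ∑ᶠ p ∈ T, (Mono (p.1 ++ p.2) + odot (Mono p.1) (Mono p.2)) =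
      ∑ᶠ p ∈ T, (Mono (p.1 ++ p.2) + Mono (nc p)) := by
    refine finsum_mem_congr rfl fun p hp => ?_
    obtain ⟨g, c, d, h, rfl, -⟩ := key p hp
    rw [nc_eq, odot_eq]
  have hS : {σ | DComp.StrongLe σ (A ++ undot (a + b) :: B)} =
      (fun p : DComp × DComp => p.1 ++ p.2) '' T ∪ nc '' T := by
    ext σ
    constructor
    · intro hh
      rcases surj hh with ⟨γ, η, h1, h2, rfl⟩ | ⟨g, c, d, h, h1, h2, rfl⟩
      · exact .inl ⟨(γ, η), ⟨h1, h2⟩, rfl⟩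
      · exact .inr ⟨(_, _), ⟨h1, h2⟩, nc_eq g h c d⟩
    · rintro (⟨⟨γ, η⟩, ⟨h1, h2⟩, rfl⟩ | ⟨p, hp, rfl⟩)
      · have t1 : StrongLe (γ ++ η) ((A ++ [undot a]) ++ η) := by
          simpa using le_append h1 [] η
        have t2 : StrongLe ((A ++ [undot a]) ++ η) ((A ++ [undot a]) ++ undot b :: B) := by
          simpa using le_append h2 (A ++ [undot a]) []
        have t3 : StrongLe ((A ++ [undot a]) ++ undot b :: B) (A ++ undot (a + b) :: B) := by
          simpa using @cover_le A B a b
        exact (t1.trans t2).trans t3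
      · obtain ⟨g, c, d, h, rfl, h3⟩ := key p hp
        rw [nc_eq]
        exact h3
  have i1 : Set.InjOn (fun p : DComp × DComp => p.1 ++ p.2) T := by
    intro p hp q hq h
    obtain ⟨h1, h2⟩ := inj1 h (hW p hp q hq)
    exact Prod.ext h1 h2
  have i2 : Set.InjOn nc T := by
    intro p hp q hq H
    have hw := hW p hp q hq
    obtain ⟨g, c, d, h, rfl, -⟩ := key p hp
    obtain ⟨g', c', d', h', rfl, -⟩ := key q hq
    rw [nc_eq, nc_eq] at H
    obtain ⟨rfl, rfl, rfl, rfl⟩ := inj2 H hw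
    rfl
  have hd : Disjoint ((fun p : DComp × DComp => p.1 ++ p.2) '' T) (nc '' T) := by
    rw [Set.disjoint_left]
    rintro σ ⟨p, hp, rfl⟩ ⟨q, hq, H⟩
    have hw := hW p hp q hq
    obtain ⟨g', c', d', h', rfl, -⟩ := key q hq
    rw [nc_eq] at H
    exact disj H.symm hw
  rw [e1, finsum_mem_add_distrib hfin, hS,
    finsum_mem_union hd (hfin.image _) (hfin.image _), finsum_mem_image i1, finsum_mem_image i2]
end

section
/- Every nonempty dotted composition γ can be written as γ = α^{(1)} ⊙ α^{(2)} ⊙ ⋯ ⊙ α^{(ℓ)}, where each α^{(i)} is a column, the first entry of α^{(i)} is undotted (hence equal to 1) for all i ≥ 2, and the last entry of α^{(i)} is undotted (hence equal to 1) for all i ≤ ℓ−1; moreover this decomposition is unique. -/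
/-- A dotted composition is a column if every undotted entry equals `1`. -/
def IsColumn (α : DComp) : Prop := ∀ e ∈ α, e.isDot = true ∨ e = DEntry.undot 1

/-- Iterated near concatenation, taken left to right, of a list of dotted
compositions (partial). -/
def nearConcatFold : List DComp → Option DComp
  | [] => none
  | a :: rest => rest.foldl (fun acc b => acc.bind fun x => DComp.nearConcat x b) (some a)

namespace ColDec

/-- Consecutive blocks condition. -/
def R (a b : DComp) : Prop :=
  (∃ n, a.getLast? = some (DEntry.undot n)) ∧ b.head? = some (DEntry.undot 1)

/-- Expand a first entry. -/
def ex : DEntry → DComp → List DComp → List DComp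
  | DEntry.dot k, a, r => (DEntry.dot k :: a) :: r
  | DEntry.undot n, a, r =>
    List.replicate ((n : ℕ) - 1) [DEntry.undot 1] ++ (DEntry.undot 1 :: a) :: r

/-- The decomposition. -/
def dec : DComp → List DComp
  | [] => []
  | e :: g => match dec g with
    | [] => ex e [] []
    | a :: r => ex e a r

theorem fold_none (r : List DComp) :
    r.foldl (fun acc b => acc.bind fun x => DComp.nearConcat x b) none = none := by
  induction r with
  | nil => rfl
  | cons b r ih => simpa using ih

theorem fold_cons2 (a b : DComp) (r : List DComp) :
    nearConcatFold (a :: b :: r) = (DComp.nearConcat a b).bind fun c => nearConcatFold (c :: r) := by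
  simp only [nearConcatFold, List.foldl_cons, Option.bind_some]
  cases DComp.nearConcat a b with
  | none => simp [fold_none]
  | some c => simp

theorem near_cons (e f : DEntry) (a b : DComp) :
    DComp.nearConcat (e :: f :: a) b = (DComp.nearConcat (f :: a) b).map (e :: ·) := by
  cases b with
  | nil => rfl
  | cons y ys =>
    simp only [DComp.nearConcat, List.getLast?_cons_cons, List.dropLast_cons_cons]
    cases h : (f :: a).getLast? with
    | none => rfl
    | some x => simp [Function.comp_def]

theorem near_ne (a b c : DComp) (h : DComp.nearConcat a b = some c) : ∃ x xs, c = x :: xs := by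
  cases c with
  | cons x xs => exact ⟨x, xs, rfl⟩
  | nil =>
    cases b with
    | nil => simp [DComp.nearConcat] at h
    | cons y ys =>
      simp only [DComp.nearConcat] at h
      split at h <;> simp at h

theorem fold_cons (e f : DEntry) (a : DComp) (r : List DComp) :
    nearConcatFold ((e :: f :: a) :: r) = (nearConcatFold ((f :: a) :: r)).map (e :: ·) := by
  induction r generalizing f a with
  | nil => simp [nearConcatFold]
  | cons b r ih =>
    rw [fold_cons2, fold_cons2, near_cons]
    cases h : DComp.nearConcat (f :: a) b with
    | none => rfl
    | some c =>
      obtain ⟨x, xs, rfl⟩ := near_ne _ _ _ h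
      simpa using ih x xs

theorem fold_merge (n : ℕ+) (b : DComp) (r : List DComp) :
    nearConcatFold ([DEntry.undot n] :: (DEntry.undot 1 :: b) :: r) =
      nearConcatFold ((DEntry.undot (n + 1) :: b) :: r) := by
  rw [fold_cons2]; simp [DComp.nearConcat, DEntry.add?]

theorem isCol_cons {e : DEntry} {a : DComp} :
    IsColumn (e :: a) ↔ (e.isDot = true ∨ e = DEntry.undot 1) ∧ IsColumn a := by
  simp [IsColumn]

theorem ex_col {e : DEntry} (h : e.isDot = true ∨ e = DEntry.undot 1) (a : DComp) (r : List DComp) :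
    ex e a r = (e :: a) :: r := by
  cases e with
  | dot k => rfl
  | undot n =>
    have : n = 1 := by simpa [DEntry.isDot] using h
    subst this
    simp [ex]

theorem ex_succ (n : ℕ+) (b : DComp) (r : List DComp) :
    ex (DEntry.undot (n + 1)) b r = ex (DEntry.undot n) [] ((DEntry.undot 1 :: b) :: r) := by
  obtain ⟨m, rfl⟩ : ∃ m : ℕ, n = m.succPNat := ⟨n.natPred, by simp⟩
  simp only [ex, PNat.add_coe, Nat.succPNat_coe, PNat.one_coe, Nat.succ_eq_add_one,
    Nat.add_sub_cancel, List.replicate_succ']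
  simp

theorem R_head {e : DEntry} {n : ℕ+} {a b : DComp} (h : R (DEntry.undot n :: a) b) (m : ℕ+) :
    R (DEntry.undot m :: a) b := by
  cases a with
  | nil => exact ⟨⟨m, rfl⟩, h.2⟩
  | cons x xs => simpa [R] using h

theorem chain_head {n : ℕ+} {a : DComp} {r : List DComp}
    (h : List.IsChain R ((DEntry.undot n :: a) :: r)) (m : ℕ+) :
    List.IsChain R ((DEntry.undot m :: a) :: r) := by
  cases r with
  | nil => simp
  | cons b r =>
    rw [List.isChain_cons_cons] at h ⊢
    exact ⟨R_head (e := DEntry.dot 0) h.1 m, h.2⟩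

theorem uniq (r : List DComp) : ∀ (a : DComp) (e : DEntry) (g : DComp), IsColumn a →
    (∀ b ∈ r, IsColumn b) → List.IsChain R ((e :: a) :: r) →
    nearConcatFold ((e :: a) :: r) = some g → dec g = ex e a r := by
  induction r with
  | nil =>
    intro a
    induction a with
    | nil =>
      intro e g _ _ _ h
      simp [nearConcatFold] at h
      subst h
      simp [dec]
    | cons f a ih =>
      intro e g hc _ _ h
      simp [nearConcatFold] at h
      subst h
      have hc' := isCol_cons.1 hc
      have := ih f (f :: a) hc'.2 (by simp) (by simp) rfl
      rw [ex_col hc'.1] at this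
      rw [dec, this]
  | cons b r ihr =>
    intro a
    induction a with
    | nil =>
      intro e g _ hr hch h
      rw [List.isChain_cons_cons] at hch
      obtain ⟨⟨⟨n, hn⟩, hb⟩, hch⟩ := hch
      cases b with
      | nil => simp at hb
      | cons y b =>
        simp at hn hb
        subst hn hb
        rw [fold_merge] at h
        rw [← ex_succ]
        exact ihr _ _ _ (isCol_cons.1 (hr _ List.mem_cons_self)).2
          (fun b hb => hr b (by simp [hb])) (chain_head hch _) h
    | cons f a ih =>
      intro e g hc hr hch h
      rw [fold_cons] at h
      cases h' : nearConcatFold ((f :: a) :: b :: r) with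
      | none => simp [h'] at h
      | some g' =>
        simp [h'] at h
        subst h
        have hc' := isCol_cons.1 hc
        have := ih f g' hc'.2 hr (by
          rw [List.isChain_cons_cons] at hch ⊢
          exact ⟨by simpa [R] using hch.1, hch.2⟩) h'
        rw [ex_col hc'.1] at this
        rw [dec, this]

/-- Valid decompositions. -/
def Good (g : DComp) (as : List DComp) : Prop :=
  as ≠ [] ∧ (∀ a ∈ as, IsColumn a ∧ a ≠ []) ∧ List.IsChain R as ∧ nearConcatFold as = some g

theorem good_ex_undot (k : ℕ) : ∀ (g a : DComp) (r : List DComp), IsColumn a →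
    (∀ b ∈ r, IsColumn b ∧ b ≠ []) → List.IsChain R ((DEntry.undot k.succPNat :: a) :: r) →
    nearConcatFold ((DEntry.undot k.succPNat :: a) :: r) = some g →
    Good g (ex (DEntry.undot k.succPNat) a r) := by
  induction k with
  | zero =>
    intro g a r ha hr hc h
    have h1 : (0 : ℕ).succPNat = 1 := rfl
    rw [h1] at *
    rw [ex_col (Or.inr rfl)]
    refine ⟨by simp, ?_, hc, h⟩
    intro b hb
    rcases List.mem_cons.1 hb with rfl | hb
    · exact ⟨isCol_cons.2 ⟨Or.inr rfl, ha⟩, by simp⟩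
    · exact hr b hb
  | succ k ih =>
    intro g a r ha hr hc h
    have h1 : (k + 1).succPNat = k.succPNat + 1 := rfl
    rw [h1] at *
    rw [ex_succ]
    apply ih
    · simp [IsColumn]
    · intro b hb
      rcases List.mem_cons.1 hb with rfl | hb
      · exact ⟨isCol_cons.2 ⟨Or.inr rfl, ha⟩, by simp⟩
      · exact hr b hb
    · rw [List.isChain_cons_cons]
      exact ⟨⟨⟨_, rfl⟩, rfl⟩, chain_head hc _⟩
    · rw [fold_merge]; exact h

theorem good_ex (e : DEntry) (g a : DComp) (r : List DComp) (ha : IsColumn a)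
    (hr : ∀ b ∈ r, IsColumn b ∧ b ≠ []) (hc : List.IsChain R ((e :: a) :: r))
    (h : nearConcatFold ((e :: a) :: r) = some g) : Good g (ex e a r) := by
  cases e with
  | undot n =>
    obtain ⟨m, rfl⟩ : ∃ m : ℕ, n = m.succPNat := ⟨n.natPred, by simp⟩
    exact good_ex_undot m g a r ha hr hc h
  | dot k =>
    refine ⟨by simp [ex], ?_, hc, h⟩
    intro b hb
    rcases List.mem_cons.1 hb with rfl | hb
    · exact ⟨isCol_cons.2 ⟨Or.inl rfl, ha⟩, by simp⟩
    · exact hr b hb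

theorem good_dec (g : DComp) (hg : g ≠ []) : Good g (dec g) := by
  induction g with
  | nil => exact absurd rfl hg
  | cons e g ih =>
    cases g with
    | nil => exact good_ex e [e] [] [] (by simp [IsColumn]) (by simp) (by simp) rfl
    | cons f g =>
      have ih := ih (by simp)
      rw [dec]
      revert ih
      generalize dec (f :: g) = X
      intro ih
      obtain ⟨h1, h2, h3, h4⟩ := ih
      cases X with
      | nil => exact absurd rfl h1
      | cons a r =>
        cases a with
        | nil => exact absurd rfl (h2 [] (by simp)).2
        | cons x a =>
          apply good_ex
          · exact (h2 _ (by simp)).1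
          · exact fun b hb => h2 b (by simp [hb])
          · cases r with
            | nil => simp
            | cons b r =>
              rw [List.isChain_cons_cons] at h3 ⊢
              exact ⟨by simpa [R] using h3.1, h3.2⟩
          · rw [fold_cons, h4]; rfl

theorem good_uniq (g : DComp) (as : List DComp) (h : Good g as) : as = dec g := by
  obtain ⟨h1, h2, h3, h4⟩ := h
  cases as with
  | nil => exact absurd rfl h1
  | cons a r =>
    cases a with
    | nil => exact absurd rfl (h2 [] (by simp)).2
    | cons e a =>
      have hc := isCol_cons.1 (h2 _ List.mem_cons_self).1
      rw [uniq r a e g hc.2 (fun b hb => (h2 b (by simp [hb])).1) h3 h4, ex_col hc.1]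

theorem undot_one {a : DComp} (ha : IsColumn a) {x : DEntry} (hx : x ∈ a) (h : x.isDot = false) :
    x = DEntry.undot 1 := by
  rcases ha x hx with h' | h'
  · simp [h] at h'
  · exact h'

theorem good_iff (g : DComp) (hg : g ≠ []) (as : List DComp) :
    (as ≠ [] ∧ (∀ a ∈ as, IsColumn a) ∧
      (∀ i, 0 < i → ∀ h : i < as.length,
        ∃ x : DEntry, (as.get ⟨i, h⟩).head? = some x ∧ x.isDot = false) ∧
      (∀ i, ∀ h : i < as.length, i + 1 < as.length →
        ∃ x : DEntry, (as.get ⟨i, h⟩).getLast? = some x ∧ x.isDot = false) ∧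
      nearConcatFold as = some g) ↔ Good g as := by
  constructor
  · rintro ⟨h1, h2, h3, h4, h5⟩
    refine ⟨h1, fun a ha => ⟨h2 a ha, ?_⟩, ?_, h5⟩
    · rintro rfl
      obtain ⟨i, hi, hia⟩ := List.getElem_of_mem ha
      by_cases h0 : 0 < i
      · obtain ⟨x, hx, _⟩ := h3 i h0 hi
        simp [hia] at hx
      · by_cases h6 : i + 1 < as.length
        · obtain ⟨x, hx, _⟩ := h4 i hi h6
          simp [hia] at hx
        · have hi0 : i = 0 := by omega
          subst hi0
          cases as with
          | nil => exact h1 rfl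
          | cons a r =>
            cases r with
            | nil =>
              simp at hia
              subst hia
              simp [nearConcatFold] at h5
              exact hg h5
            | cons b r => simp at h6
    · rw [List.isChain_iff_getElem]
      intro i hi
      obtain ⟨x, hx, hx'⟩ := h4 i (by omega) hi
      obtain ⟨y, hy, hy'⟩ := h3 (i + 1) (by omega) hi
      have e1 := undot_one (h2 _ (List.get_mem _ _)) (List.mem_of_getLast? hx) hx'
      have e2 := undot_one (h2 _ (List.get_mem _ _)) (List.mem_of_head? hy) hy'
      subst e1 e2
      exact ⟨⟨1, hx⟩, hy⟩
  · rintro ⟨h1, h2, h3, h4⟩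
    rw [List.isChain_iff_getElem] at h3
    refine ⟨h1, fun a ha => (h2 a ha).1, ?_, ?_, h4⟩
    · intro i hi h
      obtain ⟨j, rfl⟩ : ∃ j, i = j + 1 := ⟨i - 1, by omega⟩
      exact ⟨_, (h3 j h).2, rfl⟩
    · intro i h hi
      obtain ⟨n, hn⟩ := (h3 i hi).1
      exact ⟨_, hn, rfl⟩

end ColDec

/-- Every nonempty dotted composition `γ` can be written uniquely
as `γ = α⁽¹⁾ ⊙ ⋯ ⊙ α⁽ℓ⁾` where each `α⁽ⁱ⁾` is a column, the first entry of `α⁽ⁱ⁾`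
is undotted for all `i ≥ 2`, and the last entry of `α⁽ⁱ⁾` is undotted for all
`i ≤ ℓ−1`. -/
theorem column_decomposition_existsUnique (γ : DComp) (hγ : γ ≠ []) :
    ∃! as : List DComp,
      as ≠ [] ∧ (∀ a ∈ as, IsColumn a) ∧
      (∀ i, 0 < i → ∀ h : i < as.length,
        ∃ x : DEntry, (as.get ⟨i, h⟩).head? = some x ∧ x.isDot = false) ∧
      (∀ i, ∀ h : i < as.length, i + 1 < as.length →
        ∃ x : DEntry, (as.get ⟨i, h⟩).getLast? = some x ∧ x.isDot = false) ∧
      nearConcatFold as = some γ := by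
  simp only [ColDec.good_iff γ hγ]
  exact ⟨ColDec.dec γ, ColDec.good_dec γ hγ, fun as h => ColDec.good_uniq γ as h⟩
end
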